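/- arXiv:math/0607188 — 8 statements merged into one kernel-verified Lean document; each statement's English description precedes it below -/
import Mathlib

section
/- (Transport of spectral multiplets along isometric intertwiners.) Let c : Fin d → C be a u-multiplet which is a linearly independent family, let z ∈ M_e(A), and let S be a d×e complex matrix which is an isometry (Sᴴ·S = 1_e) and intertwines z with u over A, i.e. Σ_k u_{ik}·S_{kj} = Σ_k S_{ik}·z_{kj} in A for all i, j (complex scalars acting on A via the algebra structure). Then the family f : Fin e → C defined by f_i := Σ_j S_{ji} • c_j is a z-multiplet and is linearly independent. -/
open scoped TensorProduct
open Matrix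

/-- Transport of spectral multiplets along isometric intertwiners.
If `c` is a linearly independent `u`-multiplet for the coaction `η : C → C ⊗ A`,
`S` is a complex `d × e` isometry (`Sᴴ·S = 1`) intertwining `z` with `u`
(`∑ₖ u i k • S k j = ∑ₖ S i k • z k j` in `A`), then `f i := ∑ⱼ S j i • c j` is a
linearly independent `z`-multiplet. -/
theorem multiplet_transport {A C : Type*} [Ring A] [Algebra ℂ A] [Ring C] [Algebra ℂ C]
    (η : C →ₐ[ℂ] C ⊗[ℂ] A) {d e : ℕ}
    (u : Matrix (Fin d) (Fin d) A) (z : Matrix (Fin e) (Fin e) A)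
    (c : Fin d → C) (hc : ∀ i, η (c i) = ∑ j, c j ⊗ₜ[ℂ] u j i)
    (hci : LinearIndependent ℂ c)
    (S : Matrix (Fin d) (Fin e) ℂ) (hS : Sᴴ * S = 1)
    (hint : ∀ i j, ∑ k, S k j • u i k = ∑ k, S i k • z k j)
    (f : Fin e → C) (hf : ∀ i, f i = ∑ j, S j i • c j) :
    (∀ i, η (f i) = ∑ j, f j ⊗ₜ[ℂ] z j i) ∧ LinearIndependent ℂ f := by
  refine ⟨fun i => ?_, ?_⟩
  · calc η (f i) = ∑ j, ∑ k, c k ⊗ₜ[ℂ] (S j i • u k j) := by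
          simp only [hf, map_sum, map_smul, hc, Finset.smul_sum, TensorProduct.tmul_smul]
      _ = ∑ k, c k ⊗ₜ[ℂ] (∑ j, S j i • u k j) := by
          rw [Finset.sum_comm]
          simp only [TensorProduct.tmul_sum]
      _ = ∑ k, ∑ j, c k ⊗ₜ[ℂ] (S k j • z j i) := by
          simp only [hint, TensorProduct.tmul_sum]
      _ = ∑ j, f j ⊗ₜ[ℂ] z j i := by
          rw [Finset.sum_comm]
          simp only [hf, TensorProduct.sum_tmul, TensorProduct.smul_tmul]
  · rw [Fintype.linearIndependent_iff] at hci ⊢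
    intro g hg
    have hsum : ∑ j, (S *ᵥ g) j • c j = 0 := by
      rw [← hg]
      simp only [hf, mulVec, dotProduct, Finset.sum_smul, Finset.smul_sum, smul_smul]
      rw [Finset.sum_comm]
      simp only [mul_comm]
    have hSg : S *ᵥ g = 0 := funext (hci _ hsum)
    have hg0 : g = 0 := by
      rw [← one_mulVec g, ← hS, ← mulVec_mulVec, hSg, mulVec_zero]
    exact congrFun hg0
end

section
/- (The stabilizer of a state is closed under subobjects and direct sums.) Let B and A be unital ℂ-algebras, α : B → B ⊗ A a unital ℂ-algebra homomorphism, and φ : B → ℂ a ℂ-linear functional. (i) If π : A → M_n(ℂ) belongs to S_φ, π' : A → M_{n'}(ℂ) is a unital algebra homomorphism, and W is an n×n' complex matrix with Wᴴ·W = 1_{n'} and π(a)·W = W·π'(a) for all a ∈ A, then π' belongs to S_φ. (ii) If π : A → M_n(ℂ) is a unital algebra homomorphism, (π_i : A → M_{n_i}(ℂ))_{i∈I} is a finite family in S_φ, and (W_i)_{i∈I} are n×n_i complex matrices with π(a)·W_i = W_i·π_i(a) for all a and Σ_i W_i·W_iᴴ = 1_n, then π belongs to S_φ. -/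
open scoped TensorProduct
open Matrix

/-- The linear map `φ ⊗ π : B ⊗ A → M` determined by `b ⊗ a ↦ φ(b) • π(a)`. -/
noncomputable def phiTensor {B A M : Type*} [Ring B] [Algebra ℂ B] [Ring A] [Algebra ℂ A]
    [AddCommGroup M] [Module ℂ M] (φ : B →ₗ[ℂ] ℂ) (π : A →ₗ[ℂ] M) :
    B ⊗[ℂ] A →ₗ[ℂ] M :=
  TensorProduct.lift ((LinearMap.lcomp ℂ M π).comp ((LinearMap.lsmul ℂ M).comp φ))

/-- Membership in the stabilizer `S_φ` of the linear functional `φ` under the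
coaction `α : B → B ⊗ A`: the unital algebra homomorphism
`π : A → M_ι(ℂ)` satisfies `(φ ⊗ π)(α(b)) = φ(b) • 1` for every `b ∈ B`. -/
def InStab {B A : Type*} [Ring B] [Algebra ℂ B] [Ring A] [Algebra ℂ A]
    (α : B →ₐ[ℂ] B ⊗[ℂ] A) (φ : B →ₗ[ℂ] ℂ)
    {ι : Type} [Fintype ι] [DecidableEq ι] (π : A →ₐ[ℂ] Matrix ι ι ℂ) : Prop :=
  ∀ b : B, phiTensor φ π.toLinearMap (α b) = φ b • (1 : Matrix ι ι ℂ)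

/-- A linear intertwining relation `π a * W = W * π' a` passes to `φ ⊗ π` and `φ ⊗ π'`. -/
lemma phiTensor_mul_of_intertwines {B A : Type*} [Ring B] [Algebra ℂ B] [Ring A] [Algebra ℂ A]
    (φ : B →ₗ[ℂ] ℂ) {m n : Type*} [Fintype m] [Fintype n]
    (π : A →ₗ[ℂ] Matrix m m ℂ) (π' : A →ₗ[ℂ] Matrix n n ℂ) (W : Matrix m n ℂ)
    (h : ∀ a, π a * W = W * π' a) (x : B ⊗[ℂ] A) :
    phiTensor φ π x * W = W * phiTensor φ π' x := by
  induction x using TensorProduct.induction_on with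
  | zero => simp
  | tmul b a => simp [phiTensor, h]
  | add x y hx hy => simp [Matrix.add_mul, Matrix.mul_add, hx, hy]

/-- The stabilizer of a state is closed under subobjects (i) and
finite direct sums (ii). -/
theorem stabilizer_subobjects_directSums {B A : Type*}
    [Ring B] [Algebra ℂ B] [Ring A] [Algebra ℂ A]
    (α : B →ₐ[ℂ] B ⊗[ℂ] A) (φ : B →ₗ[ℂ] ℂ) :
    (∀ (n n' : ℕ) (π : A →ₐ[ℂ] Matrix (Fin n) (Fin n) ℂ)
        (π' : A →ₐ[ℂ] Matrix (Fin n') (Fin n') ℂ)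
        (W : Matrix (Fin n) (Fin n') ℂ),
        InStab α φ π → Wᴴ * W = 1 → (∀ a, π a * W = W * π' a) →
        InStab α φ π') ∧
    (∀ (n : ℕ) (π : A →ₐ[ℂ] Matrix (Fin n) (Fin n) ℂ)
        (I : Type) (_ : Fintype I) (nI : I → ℕ)
        (πI : ∀ i, A →ₐ[ℂ] Matrix (Fin (nI i)) (Fin (nI i)) ℂ)
        (W : ∀ i, Matrix (Fin n) (Fin (nI i)) ℂ),
        (∀ i, InStab α φ (πI i)) →
        (∀ i a, π a * W i = W i * πI i a) →
        (∑ i, W i * (W i)ᴴ = 1) →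
        InStab α φ π) := by
  refine ⟨fun n n' π π' W hπ hW h b => ?_, fun n π I _ nI πI W hπI h hW b => ?_⟩
  · calc phiTensor φ π'.toLinearMap (α b)
        = Wᴴ * (W * phiTensor φ π'.toLinearMap (α b)) := by
          rw [← Matrix.mul_assoc, hW, Matrix.one_mul]
      _ = φ b • (1 : Matrix (Fin n') (Fin n') ℂ) := by
          rw [← phiTensor_mul_of_intertwines φ π.toLinearMap π'.toLinearMap W h, hπ b,
            Matrix.smul_mul, Matrix.one_mul, Matrix.mul_smul, hW]
  · calc phiTensor φ π.toLinearMap (α b)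
        = ∑ i, phiTensor φ π.toLinearMap (α b) * W i * (W i)ᴴ := by
          simp only [Matrix.mul_assoc]
          rw [← Matrix.mul_sum, hW, Matrix.mul_one]
      _ = ∑ i, φ b • (W i * (W i)ᴴ) := by
          refine Finset.sum_congr rfl fun i _ => ?_
          rw [phiTensor_mul_of_intertwines φ π.toLinearMap (πI i).toLinearMap (W i) (h i),
            hπI i b, Matrix.mul_smul, Matrix.mul_one, Matrix.smul_mul]
      _ = φ b • (1 : Matrix (Fin n) (Fin n) ℂ) := by
          rw [← Finset.smul_sum, hW]
end

section
/- (The stabilizer of a state is closed under tensor products.) Let B and A be unital ℂ-algebras, Δ : A → A ⊗ A a unital ℂ-algebra homomorphism, α : B → B ⊗ A a unital ℂ-algebra homomorphism satisfying the coaction identity (α ⊗ id_A) ∘ α = (id_B ⊗ Δ) ∘ α, and φ : B → ℂ a ℂ-linear functional. For unital algebra homomorphisms π : A → M_n(ℂ) and π' : A → M_{n'}(ℂ), define π∗π' : A → M_{n·n'}(ℂ) as the composite of Δ with the ℂ-linear map A ⊗ A → M_{n·n'}(ℂ) determined by a ⊗ a' ↦ π(a) ⊗ π'(a') (Kronecker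 product of matrices). If π ∈ S_φ and π' ∈ S_φ then π∗π' ∈ S_φ. -/
open scoped TensorProduct Kronecker
open Matrix

/-- `M ↦ M ⊗ₖ 1` as an algebra homomorphism. -/
noncomputable def kronLeftHom (m n : Type) [Fintype m] [DecidableEq m]
    [Fintype n] [DecidableEq n] :
    Matrix m m ℂ →ₐ[ℂ] Matrix (m × n) (m × n) ℂ where
  toFun M := M ⊗ₖ (1 : Matrix n n ℂ)
  map_one' := Matrix.one_kronecker_one
  map_mul' M N := by simpa using Matrix.mul_kronecker_mul M N (1 : Matrix n n ℂ) 1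
  map_zero' := Matrix.zero_kronecker 1
  map_add' M N := Matrix.add_kronecker M N 1
  commutes' c := by
    simp [Algebra.algebraMap_eq_smul_one, Matrix.smul_kronecker, Matrix.one_kronecker_one]

/-- `N ↦ 1 ⊗ₖ N` as an algebra homomorphism. -/
noncomputable def kronRightHom (m n : Type) [Fintype m] [DecidableEq m]
    [Fintype n] [DecidableEq n] :
    Matrix n n ℂ →ₐ[ℂ] Matrix (m × n) (m × n) ℂ where
  toFun N := (1 : Matrix m m ℂ) ⊗ₖ N
  map_one' := Matrix.one_kronecker_one
  map_mul' M N := by simpa using Matrix.mul_kronecker_mul (1 : Matrix m m ℂ) 1 M N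
  map_zero' := Matrix.kronecker_zero 1
  map_add' M N := Matrix.kronecker_add 1 M N
  commutes' c := by
    simp [Algebra.algebraMap_eq_smul_one, Matrix.kronecker_smul, Matrix.one_kronecker_one]

lemma kron_commute {m n : Type} [Fintype m] [DecidableEq m] [Fintype n] [DecidableEq n]
    (M : Matrix m m ℂ) (N : Matrix n n ℂ) :
    Commute (M ⊗ₖ (1 : Matrix n n ℂ)) ((1 : Matrix m m ℂ) ⊗ₖ N) := by
  show _ * _ = _ * _
  rw [← Matrix.mul_kronecker_mul, ← Matrix.mul_kronecker_mul, one_mul, mul_one, one_mul,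
    mul_one]

/-- The convolution product `π ∗ π'` of two finite dimensional representations of `A`:
the composite of `Δ` with the map `A ⊗ A → M_{n·n'}(ℂ)` determined by
`a ⊗ a' ↦ π(a) ⊗ π'(a')` (Kronecker product). -/
noncomputable def convProd {A : Type*} [Ring A] [Algebra ℂ A]
    (Δ : A →ₐ[ℂ] A ⊗[ℂ] A) {n n' : ℕ}
    (π : A →ₐ[ℂ] Matrix (Fin n) (Fin n) ℂ)
    (π' : A →ₐ[ℂ] Matrix (Fin n') (Fin n') ℂ) :
    A →ₐ[ℂ] Matrix (Fin n × Fin n') (Fin n × Fin n') ℂ :=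
  (Algebra.TensorProduct.lift ((kronLeftHom (Fin n) (Fin n')).comp π)
    ((kronRightHom (Fin n) (Fin n')).comp π')
    (fun x y => kron_commute (π x) (π' y))).comp Δ

@[simp]
lemma phiTensor_tmul {B A M : Type*} [Ring B] [Algebra ℂ B] [Ring A] [Algebra ℂ A]
    [AddCommGroup M] [Module ℂ M] (φ : B →ₗ[ℂ] ℂ) (π : A →ₗ[ℂ] M) (b : B) (a : A) :
    phiTensor φ π (b ⊗ₜ[ℂ] a) = φ b • π a := rfl

/-- Precomposing the second leg of `φ ⊗ π` with a linear map. -/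
lemma phiTensor_comp {B A C M : Type*} [Ring B] [Algebra ℂ B] [Ring A] [Algebra ℂ A]
    [Ring C] [Algebra ℂ C] [AddCommGroup M] [Module ℂ M]
    (φ : B →ₗ[ℂ] ℂ) (π : C →ₗ[ℂ] M) (f : A →ₗ[ℂ] C) (x : B ⊗[ℂ] A) :
    phiTensor φ (π ∘ₗ f) x = phiTensor φ π (TensorProduct.map LinearMap.id f x) := by
  induction x with
  | zero => simp
  | tmul b a => simp
  | add x y hx hy => simp only [map_add, hx, hy]

/-- Postcomposing `φ ⊗ π` with a linear map. -/
lemma map_phiTensor {B A M N : Type*} [Ring B] [Algebra ℂ B] [Ring A] [Algebra ℂ A]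
    [AddCommGroup M] [Module ℂ M] [AddCommGroup N] [Module ℂ N]
    (φ : B →ₗ[ℂ] ℂ) (π : A →ₗ[ℂ] M) (g : M →ₗ[ℂ] N) (x : B ⊗[ℂ] A) :
    g (phiTensor φ π x) = phiTensor φ (g ∘ₗ π) x := by
  induction x with
  | zero => simp
  | tmul b a => simp
  | add x y hx hy => simp only [map_add, hx, hy]

/-- `φ ⊗ (f · g)` on a reassociated tensor is the product of `φ ⊗ f` and `g`. -/
lemma phiTensor_lift_assoc_tmul {B A R : Type*} [Ring B] [Algebra ℂ B] [Ring A] [Algebra ℂ A]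
    [Ring R] [Algebra ℂ R] (φ : B →ₗ[ℂ] ℂ) (f g : A →ₐ[ℂ] R)
    (h : ∀ x y, Commute (f x) (g y)) (y : B ⊗[ℂ] A) (a : A) :
    phiTensor φ (Algebra.TensorProduct.lift f g h).toLinearMap
        (TensorProduct.assoc ℂ B A A (y ⊗ₜ[ℂ] a)) =
      phiTensor φ f.toLinearMap y * g a := by
  induction y with
  | zero => simp
  | tmul b c => simp
  | add x y hx hy => simp only [TensorProduct.add_tmul, map_add, hx, hy, add_mul]

/-- If `φ ⊗ f` agrees with `φ(·) 1` on the image of `α`, then `f` may be dropped from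
`φ ⊗ (f · g)` on the image of `α ⊗ id`. -/
lemma phiTensor_lift_assoc_map {B A R : Type*} [Ring B] [Algebra ℂ B] [Ring A] [Algebra ℂ A]
    [Ring R] [Algebra ℂ R] (α : B →ₗ[ℂ] B ⊗[ℂ] A) (φ : B →ₗ[ℂ] ℂ) (f g : A →ₐ[ℂ] R)
    (h : ∀ x y, Commute (f x) (g y))
    (hf : ∀ b, phiTensor φ f.toLinearMap (α b) = φ b • (1 : R)) (x : B ⊗[ℂ] A) :
    phiTensor φ (Algebra.TensorProduct.lift f g h).toLinearMap
        (TensorProduct.assoc ℂ B A A (TensorProduct.map α LinearMap.id x)) =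
      phiTensor φ g.toLinearMap x := by
  induction x with
  | zero => simp
  | tmul b a =>
    rw [TensorProduct.map_tmul, phiTensor_lift_assoc_tmul, hf]
    simp
  | add x y hx hy => simp only [map_add, hx, hy]

/-- The stabilizer is closed under postcomposition with algebra homomorphisms. -/
lemma InStab.comp {B A : Type*} [Ring B] [Algebra ℂ B] [Ring A] [Algebra ℂ A]
    {α : B →ₐ[ℂ] B ⊗[ℂ] A} {φ : B →ₗ[ℂ] ℂ} {ι κ : Type} [Fintype ι] [DecidableEq ι]
    [Fintype κ] [DecidableEq κ] {ρ : A →ₐ[ℂ] Matrix ι ι ℂ} (hρ : InStab α φ ρ)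
    (k : Matrix ι ι ℂ →ₐ[ℂ] Matrix κ κ ℂ) : InStab α φ (k.comp ρ) := by
  intro b
  have hk := map_phiTensor φ ρ.toLinearMap k.toLinearMap (α b)
  rw [AlgHom.comp_toLinearMap, ← hk, hρ b]
  simp

/-- The stabilizer of a state is closed under tensor products:
if `α` is a coaction (w.r.t. the comultiplication `Δ`) and `π, π' ∈ S_φ`, then
`π ∗ π' ∈ S_φ`. -/
theorem stabilizer_tensor_product {B A : Type*}
    [Ring B] [Algebra ℂ B] [Ring A] [Algebra ℂ A]
    (Δ : A →ₐ[ℂ] A ⊗[ℂ] A) (α : B →ₐ[ℂ] B ⊗[ℂ] A)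
    (hcoact : ∀ b : B,
      (TensorProduct.assoc ℂ B A A)
          ((TensorProduct.map α.toLinearMap LinearMap.id) (α b)) =
        (TensorProduct.map LinearMap.id Δ.toLinearMap) (α b))
    (φ : B →ₗ[ℂ] ℂ)
    {n n' : ℕ} (π : A →ₐ[ℂ] Matrix (Fin n) (Fin n) ℂ)
    (π' : A →ₐ[ℂ] Matrix (Fin n') (Fin n') ℂ)
    (hπ : InStab α φ π) (hπ' : InStab α φ π') :
    InStab α φ (convProd Δ π π') := by
  intro b
  rw [convProd, AlgHom.comp_toLinearMap, phiTensor_comp, ← hcoact]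
  exact (phiTensor_lift_assoc_map α.toLinearMap φ _ _ _
    (hπ.comp (kronLeftHom (Fin n) (Fin n'))) (α b)).trans
      (hπ'.comp (kronRightHom (Fin n) (Fin n')) b)
end

section
/- (Invariance of the pairing of spectral multiplets.) Assume A and C carry star-ring structures. Let u ∈ M_d(A) be unitary, and let S, T : Fin d → C be u-multiplets such that moreover η(S_i*) = Σ_j S_j* ⊗ (u_{ji})* for all i (this holds automatically when η is a *-homomorphism for the entrywise star on C ⊗ A). Then the element Σ_i T_i·S_i* of C is invariant under the coaction: η(Σ_i T_i·S_i*) = (Σ_i T_i·S_i*) ⊗ 1. -/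
open scoped TensorProduct
open Matrix

/-- Invariance of the pairing of spectral multiplets.  If `u` is a
unitary matrix over `A`, and `S`, `T` are `u`-multiplets with the adjoints of `S`
transforming according to the entrywise star of `u`, then `∑ᵢ Tᵢ·Sᵢ*` is invariant
under the coaction. -/
theorem pairing_invariant {A C : Type*} [Ring A] [Algebra ℂ A] [StarRing A]
    [Ring C] [Algebra ℂ C] [StarRing C]
    (η : C →ₐ[ℂ] C ⊗[ℂ] A) {d : ℕ}
    (u : Matrix (Fin d) (Fin d) A)
    (hu : u * uᴴ = 1) (hu' : uᴴ * u = 1)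
    (S T : Fin d → C)
    (hS : ∀ i, η (S i) = ∑ j, S j ⊗ₜ[ℂ] u j i)
    (hT : ∀ i, η (T i) = ∑ j, T j ⊗ₜ[ℂ] u j i)
    (hSstar : ∀ i, η (star (S i)) = ∑ j, star (S j) ⊗ₜ[ℂ] star (u j i)) :
    η (∑ i, T i * star (S i)) = (∑ i, T i * star (S i)) ⊗ₜ[ℂ] (1 : A) := by
  have orthonormal_rows (j k : Fin d) : ∑ i, u j i * star (u k i) = if j = k then 1 else 0 := by
    simpa [Matrix.mul_apply, Matrix.one_apply] using congr_fun₂ hu j k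
  calc η (∑ i, T i * star (S i))
      = ∑ i, ∑ j, ∑ k, (T j * star (S k)) ⊗ₜ[ℂ] (u j i * star (u k i)) := by
        simp only [map_sum, map_mul, hT, hSstar, Finset.sum_mul_sum,
          Algebra.TensorProduct.tmul_mul_tmul]
    _ = ∑ j, ∑ k, (T j * star (S k)) ⊗ₜ[ℂ] ∑ i, u j i * star (u k i) := by
        rw [Finset.sum_comm]
        refine Finset.sum_congr rfl fun j _ => ?_
        rw [Finset.sum_comm]
        simp only [TensorProduct.tmul_sum]
    _ = (∑ i, T i * star (S i)) ⊗ₜ[ℂ] (1 : A) := by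
        simp [orthonormal_rows, TensorProduct.tmul_ite, TensorProduct.sum_tmul]
end

section
/- (The Hilbert space structure on the multiplet space of an ergodic action.) Let C be a nontrivial unital C*-algebra, A a unital ℂ-algebra with star-ring structure, and η : C → C ⊗ A a coaction such that η(x*) behaves compatibly with star on multiplets, i.e. for every u-multiplet c one has η(c_i*) = Σ_j c_j* ⊗ (u_{ji})*. Assume η is ergodic: every b ∈ C with η(b) = b ⊗ 1 is a scalar multiple of 1. Let u ∈ M_d(A) be unitary and let L_u denote the ℂ-vector space of u-multiplets. Then for all S, T ∈ L_u there is a unique scalar ⟨S,T⟩ ∈ ℂ with Σ_i T_i·S_i* = ⟨S,T⟩•1, and (S,T) ↦ ⟨S,T⟩ is an inner product on L_u: it is linear in T, conjugate-linear in S, satisfies ⟨T,T⟩ ≥ 0, and ⟨T,T⟩ = 0 implies T_i = 0 for all i. -/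
open scoped TensorProduct
open Matrix

/-- A `u`-multiplet for the coaction `η : C → C ⊗ A`. -/
def IsMultiplet {A C : Type*} [Ring A] [Algebra ℂ A] [Ring C] [Algebra ℂ C]
    (η : C →ₐ[ℂ] C ⊗[ℂ] A) {d : ℕ} (u : Matrix (Fin d) (Fin d) A)
    (c : Fin d → C) : Prop :=
  ∀ i, η (c i) = ∑ j, c j ⊗ₜ[ℂ] u j i

/-- If `u` is a co-isometry, then `∑ i, T i * star (S i)` is a fixed point of the coaction for all
`u`-multiplets `S` and `T`. -/
lemma IsMultiplet.coaction_sum_mul_star {A C : Type*} [Ring A] [Algebra ℂ A] [StarRing A]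
    [Ring C] [Algebra ℂ C] [StarRing C] {η : C →ₐ[ℂ] C ⊗[ℂ] A} {d : ℕ}
    {u : Matrix (Fin d) (Fin d) A} (hu : u * uᴴ = 1) {S T : Fin d → C}
    (hS : ∀ i, η (star (S i)) = ∑ j, star (S j) ⊗ₜ[ℂ] star (u j i))
    (hT : IsMultiplet η u T) :
    η (∑ i, T i * star (S i)) = (∑ i, T i * star (S i)) ⊗ₜ[ℂ] (1 : A) := by
  have hentry (j k : Fin d) : ∑ i, u j i * star (u k i) = if j = k then 1 else 0 := by
    simpa [Matrix.mul_apply, Matrix.one_apply] using congrFun (congrFun hu j) k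
  calc η (∑ i, T i * star (S i))
      = ∑ i, ∑ j, ∑ k, (T j * star (S k)) ⊗ₜ[ℂ] (u j i * star (u k i)) := by
        simp only [map_sum, map_mul, hT _, hS, Finset.sum_mul_sum,
          Algebra.TensorProduct.tmul_mul_tmul]
    _ = ∑ j, ∑ k, (T j * star (S k)) ⊗ₜ[ℂ] (∑ i, u j i * star (u k i)) := by
        rw [Finset.sum_comm]
        refine Finset.sum_congr rfl fun j _ ↦ ?_
        rw [Finset.sum_comm]
        simp only [TensorProduct.tmul_sum]
    _ = (∑ i, T i * star (S i)) ⊗ₜ[ℂ] (1 : A) := by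
        simp only [hentry, TensorProduct.tmul_ite, Finset.sum_ite_eq,
          Finset.mem_univ, if_true, TensorProduct.sum_tmul]

/-- A scalar multiple of the unit that is a sum of elements `T i * star (T i)` is a nonnegative
real multiple, and all `T i` vanish if the scalar does. -/
lemma CStarAlgebra.scalar_of_sum_mul_star_self {C ι : Type*} [Fintype ι] [CStarAlgebra C]
    [Nontrivial C] {T : ι → C} {z : ℂ} (h : ∑ i, T i * star (T i) = z • (1 : C)) :
    (0 ≤ z.re ∧ z.im = 0) ∧ (z = 0 → T = 0) := by
  let := CStarAlgebra.spectralOrder C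
  have := CStarAlgebra.spectralOrderedRing C
  have hpos : 0 ≤ ∑ i, T i * star (T i) := Finset.sum_nonneg fun i _ ↦ mul_star_self_nonneg (T i)
  refine ⟨?_, fun hz ↦ ?_⟩
  · have hconj : (starRingEnd ℂ) z = z := by
      have hsa := (IsSelfAdjoint.of_nonneg hpos).star_eq
      rw [h, star_smul, star_one] at hsa
      exact smul_left_injective ℂ (one_ne_zero (α := C)) hsa
    obtain ⟨r, rfl⟩ := Complex.conj_eq_iff_real.mp hconj
    have hr : (algebraMap ℝ C) r = ((r : ℂ) • (1 : C)) := by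
      rw [Algebra.algebraMap_eq_smul_one, Complex.coe_smul]
    rw [h, ← hr] at hpos
    have := spectrum_nonneg_of_nonneg hpos (x := r) (by rw [spectrum.scalar_eq]; rfl)
    simpa using this
  · rw [hz, zero_smul, Finset.sum_eq_zero_iff_of_nonneg fun i _ ↦ mul_star_self_nonneg (T i)] at h
    funext i
    exact (CStarRing.mul_star_self_eq_zero_iff _).mp (h i (Finset.mem_univ i))

/-- For an ergodic coaction of `A` on a nontrivial unital
C*-algebra `C` (with multiplet star-compatibility) and a unitary `u ∈ M_d(A)`,
the space `L_u` of `u`-multiplets carries an inner product `⟨S,T⟩` determined by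
`∑ᵢ Tᵢ·Sᵢ* = ⟨S,T⟩ • 1`: it is the unique such scalar, is linear in `T`,
conjugate-linear in `S`, positive, and definite. -/
theorem multiplet_inner_product {A C : Type*} [Ring A] [Algebra ℂ A] [StarRing A]
    [NormedRing C] [StarRing C] [CStarRing C] [NormedAlgebra ℂ C]
    [CompleteSpace C] [StarModule ℂ C] [Nontrivial C]
    (η : C →ₐ[ℂ] C ⊗[ℂ] A)
    {d : ℕ} (u : Matrix (Fin d) (Fin d) A)
    (hu : u * uᴴ = 1) (hu' : uᴴ * u = 1)
    (hstar : ∀ c : Fin d → C, IsMultiplet η u c →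
      ∀ i, η (star (c i)) = ∑ j, star (c j) ⊗ₜ[ℂ] star (u j i))
    (herg : ∀ b : C, η b = b ⊗ₜ[ℂ] (1 : A) → ∃ z : ℂ, b = z • 1) :
    ∃ ip : (Fin d → C) → (Fin d → C) → ℂ,
      (∀ S T, IsMultiplet η u S → IsMultiplet η u T →
        (∑ i, T i * star (S i) = ip S T • (1 : C)) ∧
        ∀ z : ℂ, (∑ i, T i * star (S i) = z • (1 : C)) → z = ip S T) ∧
      (∀ S T T', IsMultiplet η u S → IsMultiplet η u T → IsMultiplet η u T' →
        ip S (T + T') = ip S T + ip S T') ∧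
      (∀ S T (z : ℂ), IsMultiplet η u S → IsMultiplet η u T →
        ip S (z • T) = z * ip S T) ∧
      (∀ S S' T, IsMultiplet η u S → IsMultiplet η u S' → IsMultiplet η u T →
        ip (S + S') T = ip S T + ip S' T) ∧
      (∀ S T (z : ℂ), IsMultiplet η u S → IsMultiplet η u T →
        ip (z • S) T = (starRingEnd ℂ) z * ip S T) ∧
      (∀ T, IsMultiplet η u T → 0 ≤ (ip T T).re ∧ (ip T T).im = 0) ∧
      (∀ T, IsMultiplet η u T → ip T T = 0 → T = 0) := by
  classical
  have hinj : Function.Injective fun z : ℂ ↦ z • (1 : C) :=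
    smul_left_injective ℂ (one_ne_zero (α := C))
  have hex (S T) (hS : IsMultiplet η u S) (hT : IsMultiplet η u T) :
      ∃ z : ℂ, ∑ i, T i * star (S i) = z • (1 : C) :=
    herg _ (hT.coaction_sum_mul_star hu (hstar S hS))
  let ip (S T : Fin d → C) : ℂ :=
    if h : ∃ z : ℂ, ∑ i, T i * star (S i) = z • (1 : C) then h.choose else 0
  have ip_eq {S T} {z : ℂ} (h : ∑ i, T i * star (S i) = z • (1 : C)) : ip S T = z := by
    have h' : ∃ z : ℂ, ∑ i, T i * star (S i) = z • (1 : C) := ⟨z, h⟩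
    simp only [ip, dif_pos h']
    exact hinj (h'.choose_spec.symm.trans h)
  have ip_spec (S T) (hS : IsMultiplet η u S) (hT : IsMultiplet η u T) :
      ∑ i, T i * star (S i) = ip S T • (1 : C) := by
    obtain ⟨z, hz⟩ := hex S T hS hT
    rw [ip_eq hz, hz]
  let : CStarAlgebra C := { }
  refine ⟨ip, fun S T hS hT ↦ ⟨ip_spec S T hS hT, fun z hz ↦ (ip_eq hz).symm⟩,
    fun S T T' hS hT hT' ↦ ip_eq ?_, fun S T z hS hT ↦ ip_eq ?_,
    fun S S' T hS hS' hT ↦ ip_eq ?_, fun S T z hS hT ↦ ip_eq ?_,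
    fun T hT ↦ (CStarAlgebra.scalar_of_sum_mul_star_self (ip_spec T T hT hT)).1,
    fun T hT ↦ (CStarAlgebra.scalar_of_sum_mul_star_self (ip_spec T T hT hT)).2⟩
  · simp only [Pi.add_apply, add_mul, Finset.sum_add_distrib, ip_spec S T hS hT,
      ip_spec S T' hS hT', add_smul]
  · simp only [Pi.smul_apply, smul_mul_assoc, ← Finset.smul_sum, ip_spec S T hS hT, mul_smul]
  · simp only [Pi.add_apply, star_add, mul_add, Finset.sum_add_distrib, ip_spec S T hS hT,
      ip_spec S' T hS' hT, add_smul]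
  · simp only [Pi.smul_apply, star_smul, mul_smul_comm, ← Finset.smul_sum, ip_spec S T hS hT,
      mul_smul, starRingEnd_apply]
end

section
/- (The key step in the proof that the spectral functor is quasitensor: the contraction map L_{u⊗v} → L_u.) Assume A and C carry star-ring structures. Let u ∈ M_d(A) and let v ∈ M_e(A) be unitary. Let T : Fin d × Fin e → C satisfy η(T_{(i,k)}) = Σ_{(j,l)} T_{(j,l)} ⊗ (u_{ji}·v_{lk}) for all i, k (i.e. T is a multiplet for the Kronecker product matrix u⊤v), and let S : Fin e → C be a v-multiplet with η(S_k*) = Σ_m S_m* ⊗ (v_{mk})* for all k. Then the family R : Fin d → C defined by R_i := Σ_k T_{(i,k)}·S_k* is a u-multiplet: η(R_i) = Σ_j R_j ⊗ u_{ji} for all i. -/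
open scoped TensorProduct
open Matrix

/-- The contraction map `L_{u⊗v} → L_u`.  If `T` is a multiplet for
the Kronecker product `u ⊤ v` (with `v` unitary) and `S` is a `v`-multiplet whose
adjoints transform according to the entrywise star of `v`, then
`R i := ∑ₖ T (i,k) · (S k)*` is a `u`-multiplet. -/
theorem contraction_multiplet {A C : Type*} [Ring A] [Algebra ℂ A] [StarRing A]
    [Ring C] [Algebra ℂ C] [StarRing C]
    (η : C →ₐ[ℂ] C ⊗[ℂ] A) {d e : ℕ}
    (u : Matrix (Fin d) (Fin d) A) (v : Matrix (Fin e) (Fin e) A)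
    (hv : v * vᴴ = 1) (hv' : vᴴ * v = 1)
    (T : Fin d × Fin e → C)
    (hT : ∀ i k, η (T (i, k)) = ∑ j, ∑ l, T (j, l) ⊗ₜ[ℂ] (u j i * v l k))
    (S : Fin e → C)
    (hS : ∀ k, η (S k) = ∑ l, S l ⊗ₜ[ℂ] v l k)
    (hSstar : ∀ k, η (star (S k)) = ∑ m, star (S m) ⊗ₜ[ℂ] star (v m k))
    (R : Fin d → C) (hR : ∀ i, R i = ∑ k, T (i, k) * star (S k)) :
    ∀ i, η (R i) = ∑ j, R j ⊗ₜ[ℂ] u j i := by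
  intro i
  have hv_entry (l m : Fin e) : ∑ k, v l k * star (v m k) = if l = m then 1 else 0 := by
    simpa [Matrix.mul_apply, Matrix.one_apply] using congrFun (congrFun hv l) m
  calc η (R i)
      = ∑ k, ∑ j, ∑ l, ∑ m,
          (T (j, l) * star (S m)) ⊗ₜ[ℂ] (u j i * (v l k * star (v m k))) := by
        simp only [hR, map_sum, map_mul, hT, hSstar, Finset.sum_mul, Finset.mul_sum,
          Algebra.TensorProduct.tmul_mul_tmul, mul_assoc]
        refine Finset.sum_congr rfl fun k _ => ?_
        rw [Finset.sum_comm]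
        refine Finset.sum_congr rfl fun j _ => ?_
        rw [Finset.sum_comm]
    _ = ∑ j, ∑ l, ∑ m,
          (T (j, l) * star (S m)) ⊗ₜ[ℂ] (u j i * ∑ k, v l k * star (v m k)) := by
        simp only [Finset.mul_sum, TensorProduct.tmul_sum]
        rw [Finset.sum_comm]
        refine Finset.sum_congr rfl fun j _ => ?_
        rw [Finset.sum_comm]
        refine Finset.sum_congr rfl fun l _ => ?_
        rw [Finset.sum_comm]
    _ = ∑ j, R j ⊗ₜ[ℂ] u j i := by
        simp [hv_entry, hR, TensorProduct.sum_tmul, TensorProduct.tmul_ite]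
end

section
/- (The bi-ideal generated by invariant-vector coefficients; key step of Theorem 5.1.) Let A be a unital ℂ-algebra and Δ : A → A ⊗ A a unital ℂ-algebra homomorphism. Let (u^α)_{α∈I} be a family of matrices, u^α ∈ M_{d_α}(A), each comultiplicative with respect to Δ, and for each α let K_α be a subset of ℂ^{d_α}. Let J be the two-sided ideal of A generated by the set { u^α_{φ,k} − ⟨φ,k⟩•1 : α ∈ I, φ ∈ ℂ^{d_α}, k ∈ K_α }, where u^α_{φ,k} := Σ_{j,i} conj(φ_j)·k_i • u^α_{ji} and ⟨φ,k⟩ = Σ_j conj(φ_j)·k_j. Then J is a bi-ideal: for every x ∈ J, Δ(x) lies in the ℂ-subspace A ⊗ J + J ⊗ A of A ⊗ A (the span of simple tensors with one leg in J). -/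
open scoped TensorProduct

section LegSpan

variable {R A : Type*} [CommRing R] [Ring A] [Algebra R A]

/-- The `R`-submodule `A ⊗ J + J ⊗ A` of `A ⊗ A`. -/
def TwoSidedIdeal.legSpan (R : Type*) {A : Type*} [CommRing R] [Ring A] [Algebra R A]
    (J : TwoSidedIdeal A) : Submodule R (A ⊗[R] A) :=
  Submodule.span R
    ({z : A ⊗[R] A | ∃ (a : A), ∃ y ∈ J, z = a ⊗ₜ[R] y} ∪
     {z : A ⊗[R] A | ∃ y ∈ J, ∃ (a : A), z = y ⊗ₜ[R] a})

namespace TwoSidedIdeal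

lemma tmul_mem_legSpan_right {J : TwoSidedIdeal A} (a : A) {y : A} (hy : y ∈ J) :
    a ⊗ₜ[R] y ∈ J.legSpan R :=
  Submodule.subset_span (Or.inl ⟨a, y, hy, rfl⟩)

lemma tmul_mem_legSpan_left {J : TwoSidedIdeal A} {y : A} (hy : y ∈ J) (a : A) :
    y ⊗ₜ[R] a ∈ J.legSpan R :=
  Submodule.subset_span (Or.inr ⟨y, hy, a, rfl⟩)

lemma mul_mem_legSpan_left (J : TwoSidedIdeal A) (x : A ⊗[R] A) {z : A ⊗[R] A}
    (hz : z ∈ J.legSpan R) : x * z ∈ J.legSpan R := by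
  induction x using TensorProduct.induction_on with
  | zero => simp
  | add x₁ x₂ h₁ h₂ => rw [add_mul]; exact Submodule.add_mem _ h₁ h₂
  | tmul b c =>
    induction hz using Submodule.span_induction with
    | zero => simp
    | add z₁ z₂ _ _ h₁ h₂ => rw [mul_add]; exact Submodule.add_mem _ h₁ h₂
    | smul r z _ h => rw [mul_smul_comm]; exact Submodule.smul_mem _ r h
    | mem z hz =>
      rcases hz with ⟨a, y, hy, rfl⟩ | ⟨y, hy, a, rfl⟩ <;>
        rw [Algebra.TensorProduct.tmul_mul_tmul]
      · exact tmul_mem_legSpan_right _ (J.mul_mem_left _ _ hy)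
      · exact tmul_mem_legSpan_left (J.mul_mem_left _ _ hy) _

lemma mul_mem_legSpan_right (J : TwoSidedIdeal A) {z : A ⊗[R] A}
    (hz : z ∈ J.legSpan R) (x : A ⊗[R] A) : z * x ∈ J.legSpan R := by
  induction x using TensorProduct.induction_on with
  | zero => simp
  | add x₁ x₂ h₁ h₂ => rw [mul_add]; exact Submodule.add_mem _ h₁ h₂
  | tmul b c =>
    induction hz using Submodule.span_induction with
    | zero => simp
    | add z₁ z₂ _ _ h₁ h₂ => rw [add_mul]; exact Submodule.add_mem _ h₁ h₂
    | smul r z _ h => rw [smul_mul_assoc]; exact Submodule.smul_mem _ r h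
    | mem z hz =>
      rcases hz with ⟨a, y, hy, rfl⟩ | ⟨y, hy, a, rfl⟩ <;>
        rw [Algebra.TensorProduct.tmul_mul_tmul]
      · exact tmul_mem_legSpan_right _ (J.mul_mem_right _ _ hy)
      · exact tmul_mem_legSpan_left (J.mul_mem_right _ _ hy) _

/-- To check that `Δ` maps the ideal generated by `s` into `A ⊗ J + J ⊗ A`, it is enough to
check it on `s`. -/
lemma map_mem_legSpan_of_mem_span (Δ : A →ₐ[R] A ⊗[R] A) (J : TwoSidedIdeal A) {s : Set A}
    (hs : ∀ y ∈ s, Δ y ∈ J.legSpan R) {x : A} (hx : x ∈ TwoSidedIdeal.span s) :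
    Δ x ∈ J.legSpan R := by
  induction hx using TwoSidedIdeal.span_induction with
  | mem y hy => exact hs y hy
  | zero => simp
  | add y z _ _ hy hz => rw [map_add]; exact Submodule.add_mem _ hy hz
  | neg y _ hy => rw [map_neg]; exact Submodule.neg_mem _ hy
  | left_absorb a y _ hy => rw [map_mul]; exact J.mul_mem_legSpan_left _ hy
  | right_absorb a y _ hy => rw [map_mul]; exact J.mul_mem_legSpan_right hy _

end TwoSidedIdeal

/-- For a comultiplicative matrix `u` and a vector `k`, the entries of `u k - k • 1` are
mapped by `Δ` to `∑ l, u j l ⊗ (u k - k • 1) l + (u k - k • 1) j ⊗ 1`. -/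
lemma comul_mulVec_sub {n : Type*} [Fintype n] (Δ : A →ₐ[R] A ⊗[R] A) (u : Matrix n n A)
    (hu : ∀ i j, Δ (u i j) = ∑ l, u i l ⊗ₜ[R] u l j) (k : n → R) (j : n) :
    Δ (∑ i, k i • u j i - k j • (1 : A)) =
      ∑ l, u j l ⊗ₜ[R] (∑ i, k i • u l i - k l • (1 : A)) +
        (∑ i, k i • u j i - k j • (1 : A)) ⊗ₜ[R] (1 : A) := by
  simp only [map_sub, map_sum, map_smul, hu, map_one, TensorProduct.tmul_sub,
    TensorProduct.sub_tmul, TensorProduct.tmul_sum, TensorProduct.sum_tmul,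
    TensorProduct.tmul_smul, TensorProduct.smul_tmul', Finset.sum_sub_distrib, Finset.smul_sum,
    Algebra.TensorProduct.one_def]
  rw [Finset.sum_comm]
  abel

end LegSpan



/-- The two-sided ideal generated by the elements
`u^α_{φ,k} − ⟨φ,k⟩•1` (for comultiplicative matrices `u^α` and invariant-vector
candidates `k ∈ K_α`) is a bi-ideal: `Δ` maps it into `A ⊗ J + J ⊗ A`. -/
theorem biIdeal_generated_by_invariant_coefficients {A : Type*} [Ring A] [Algebra ℂ A]
    (Δ : A →ₐ[ℂ] A ⊗[ℂ] A)
    {I : Type*} (dm : I → ℕ) (u : ∀ α, Matrix (Fin (dm α)) (Fin (dm α)) A)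
    (hcomul : ∀ α i j, Δ (u α i j) = ∑ k, u α i k ⊗ₜ[ℂ] u α k j)
    (K : ∀ α, Set (Fin (dm α) → ℂ))
    (J : TwoSidedIdeal A)
    (hJ : J = TwoSidedIdeal.span
      {y : A | ∃ (α : I) (φ : Fin (dm α) → ℂ) (k : Fin (dm α) → ℂ), k ∈ K α ∧
        y = (∑ j, ∑ i, ((starRingEnd ℂ) (φ j) * k i) • u α j i)
              - (∑ j, (starRingEnd ℂ) (φ j) * k j) • (1 : A)}) :
    ∀ x ∈ J, Δ x ∈
      Submodule.span ℂ
        ({z : A ⊗[ℂ] A | ∃ (a : A), ∃ y ∈ J, z = a ⊗ₜ[ℂ] y} ∪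
         {z : A ⊗[ℂ] A | ∃ y ∈ J, ∃ (a : A), z = y ⊗ₜ[ℂ] a}) := by
  subst hJ
  intro x hx
  refine TwoSidedIdeal.map_mem_legSpan_of_mem_span Δ _ ?_ hx
  rintro _ ⟨α, φ, k, hk, rfl⟩
  have hmem (j : Fin (dm α)) : ∑ i, k i • u α j i - k j • (1 : A) ∈ TwoSidedIdeal.span
      {y : A | ∃ (α : I) (φ : Fin (dm α) → ℂ) (k : Fin (dm α) → ℂ), k ∈ K α ∧
        y = (∑ j, ∑ i, ((starRingEnd ℂ) (φ j) * k i) • u α j i)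
              - (∑ j, (starRingEnd ℂ) (φ j) * k j) • (1 : A)} := by
    refine TwoSidedIdeal.subset_span ⟨α, Pi.single j 1, k, hk, ?_⟩
    simp [Pi.single_apply, apply_ite, ite_mul, ite_smul, Finset.sum_ite_irrel]
  have hy : (∑ j, ∑ i, ((starRingEnd ℂ) (φ j) * k i) • u α j i)
        - (∑ j, (starRingEnd ℂ) (φ j) * k j) • (1 : A) =
      ∑ j, (starRingEnd ℂ) (φ j) • (∑ i, k i • u α j i - k j • (1 : A)) := by
    simp only [smul_sub, Finset.smul_sum, Finset.sum_sub_distrib, Finset.sum_smul, smul_smul]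
  rw [hy, map_sum]
  refine sum_mem fun j _ => ?_
  rw [map_smul, comul_mulVec_sub Δ (u α) (hcomul α) k j]
  exact Submodule.smul_mem _ _ (add_mem
    (sum_mem fun l _ => TwoSidedIdeal.tmul_mem_legSpan_right _ (hmem l))
    (TwoSidedIdeal.tmul_mem_legSpan_left (hmem j) _))
end

section
/- (Proposition 8.2, uniqueness of multiplicity matrices.) Let C be a nontrivial unital C*-algebra, A a unital ℂ-algebra with star-ring structure, and η : C → C ⊗ A an ergodic coaction satisfying the multiplet star-compatibility hypothesis. Let u ∈ M_d(A) be unitary, and let c be a p×d matrix over C such that: (a) c·c* = 1_p in M_p(C); (b) each row of c is a u-multiplet, i.e. η(c_{ki}) = Σ_j c_{kj} ⊗ u_{ji}; (c) for every u-multiplet x : Fin d → C one has Σ_j x_j·(c*·c)_{ji} = x_i for all i. Then the rows of c form an orthonormal basis of the space L_u of u-multiplets with respect to the inner product determined by Σ_i T_i·S_i* = ⟨S,T⟩•1; in particular L_u is finite dimensional of dimension p. -/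
open scoped TensorProduct
open Matrix

/-- The ℂ-subspace `L_u` of `u`-multiplets for the coaction `η : C → C ⊗ A`:
families `x : Fin d → C` with `η (x i) = ∑ⱼ x j ⊗ u j i` for all `i`. -/
noncomputable def multipletSubmodule {A C : Type*} [Ring A] [Algebra ℂ A]
    [Ring C] [Algebra ℂ C]
    (η : C →ₐ[ℂ] C ⊗[ℂ] A) {d : ℕ} (u : Matrix (Fin d) (Fin d) A) :
    Submodule ℂ (Fin d → C) :=
  ⨅ i : Fin d, LinearMap.ker
    ((η.toLinearMap.comp (LinearMap.proj i)) -
      ∑ j : Fin d, ((TensorProduct.mk ℂ C A).flip (u j i)).comp (LinearMap.proj j))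

theorem mem_multipletSubmodule_iff {A C : Type*} [Ring A] [Algebra ℂ A]
    [Ring C] [Algebra ℂ C] {η : C →ₐ[ℂ] C ⊗[ℂ] A} {d : ℕ}
    {u : Matrix (Fin d) (Fin d) A} {x : Fin d → C} :
    x ∈ multipletSubmodule η u ↔ ∀ i, η (x i) = ∑ j, x j ⊗ₜ[ℂ] u j i := by
  simp [multipletSubmodule, sub_eq_zero]

/-- The pairing `∑ᵢ xᵢ yᵢ` of a `u`-multiplet with a family transforming under the entrywise
star of `u` is a fixed point of the coaction when `u * uᴴ = 1`. -/
theorem coaction_sum_mul_eq_tmul_one {A C : Type*} [Ring A] [Algebra ℂ A] [StarRing A]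
    [Ring C] [Algebra ℂ C] (η : C →ₐ[ℂ] C ⊗[ℂ] A) {d : ℕ}
    {u : Matrix (Fin d) (Fin d) A} (hu : u * uᴴ = 1) {x y : Fin d → C}
    (hx : ∀ i, η (x i) = ∑ j, x j ⊗ₜ[ℂ] u j i)
    (hy : ∀ i, η (y i) = ∑ j, y j ⊗ₜ[ℂ] star (u j i)) :
    η (∑ i, x i * y i) = (∑ i, x i * y i) ⊗ₜ[ℂ] (1 : A) := by
  have hu_entry : ∀ j k, ∑ i, u j i * star (u k i) = if j = k then 1 else 0 := fun j k => by
    simpa [Matrix.mul_apply, Matrix.one_apply] using congrFun (congrFun hu j) k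
  calc η (∑ i, x i * y i)
      = ∑ i, ∑ j, ∑ k, (x j * y k) ⊗ₜ[ℂ] (u j i * star (u k i)) := by
        simp only [map_sum, map_mul, hx, hy, Finset.sum_mul_sum,
          Algebra.TensorProduct.tmul_mul_tmul]
    _ = ∑ j, ∑ k, (x j * y k) ⊗ₜ[ℂ] (∑ i, u j i * star (u k i)) := by
        rw [Finset.sum_comm]
        refine Finset.sum_congr rfl fun j _ => ?_
        rw [Finset.sum_comm]
        simp only [TensorProduct.tmul_sum]
    _ = (∑ i, x i * y i) ⊗ₜ[ℂ] (1 : A) := by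
        simp only [hu_entry, TensorProduct.sum_tmul]
        refine Finset.sum_congr rfl fun j _ => ?_
        rw [Finset.sum_eq_single j (fun k _ hk => by simp [hk.symm]) (by simp)]
        simp

/-- The rows of a matrix with `c * cᴴ = 1` are linearly independent. -/
theorem linearIndependent_rows_of_mul_conjTranspose_eq_one {C : Type*} [Ring C] [Algebra ℂ C]
    [StarRing C] [Nontrivial C] {d p : ℕ} {c : Matrix (Fin p) (Fin d) C}
    (hcc : c * cᴴ = 1) :
    LinearIndependent ℂ (fun k : Fin p => (fun i => c k i : Fin d → C)) := by
  rw [Fintype.linearIndependent_iff]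
  intro g hg l
  have h : ∀ k, ∑ i, c k i * star (c l i) = if k = l then 1 else 0 := fun k => by
    simpa [Matrix.mul_apply, Matrix.one_apply] using congrFun (congrFun hcc k) l
  have hg_smul : g l • (1 : C) = 0 := calc
    g l • (1 : C) = ∑ k, g k • ∑ i, c k i * star (c l i) := by simp [h]
    _ = ∑ i, (∑ k, g k • c k i) * star (c l i) := by
        simp only [Finset.smul_sum, Finset.sum_mul, smul_mul_assoc]
        exact Finset.sum_comm
    _ = 0 := Finset.sum_eq_zero fun i _ => by
        have := congrFun hg i
        simp only [Finset.sum_apply, Pi.smul_apply, Pi.zero_apply] at this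
        rw [this, zero_mul]
  exact (smul_eq_zero.mp hg_smul).resolve_right one_ne_zero

/-- Proposition 8.2, uniqueness of multiplicity matrices.
For an ergodic coaction on a nontrivial unital C*-algebra (with multiplet
star-compatibility) and a unitary `u ∈ M_d(A)`, if the `p × d` matrix `c` over `C`
satisfies `c·c* = 1`, its rows are `u`-multiplets, and every `u`-multiplet `x`
satisfies `∑ⱼ xⱼ·(c*·c)ⱼᵢ = xᵢ`, then the rows of `c` form an orthonormal basis of
the space `L_u` of `u`-multiplets; in particular `L_u` has dimension `p`. -/
theorem multiplicity_matrix_rows_orthonormal_basis {A C : Type*}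
    [Ring A] [Algebra ℂ A] [StarRing A]
    [NormedRing C] [StarRing C] [CStarRing C] [NormedAlgebra ℂ C]
    [CompleteSpace C] [StarModule ℂ C] [Nontrivial C]
    (η : C →ₐ[ℂ] C ⊗[ℂ] A)
    (herg : ∀ b : C, η b = b ⊗ₜ[ℂ] (1 : A) → ∃ z : ℂ, b = z • 1)
    (hstar : ∀ (m : ℕ) (w : Matrix (Fin m) (Fin m) A), w * wᴴ = 1 → wᴴ * w = 1 →
      ∀ c : Fin m → C, (∀ i, η (c i) = ∑ j, c j ⊗ₜ[ℂ] w j i) →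
        ∀ i, η (star (c i)) = ∑ j, star (c j) ⊗ₜ[ℂ] star (w j i))
    {d p : ℕ} (u : Matrix (Fin d) (Fin d) A)
    (hu : u * uᴴ = 1) (hu' : uᴴ * u = 1)
    (c : Matrix (Fin p) (Fin d) C)
    (hcc : c * cᴴ = 1)
    (hrows : ∀ k i, η (c k i) = ∑ j, c k j ⊗ₜ[ℂ] u j i)
    (habs : ∀ x : Fin d → C, (∀ i, η (x i) = ∑ j, x j ⊗ₜ[ℂ] u j i) →
      ∀ i, ∑ j, x j * (cᴴ * c) j i = x i) :
    LinearIndependent ℂ (fun k : Fin p => (fun i => c k i : Fin d → C)) ∧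
    (∀ k l, ∑ i, c k i * star (c l i) =
      (if k = l then (1 : ℂ) else 0) • (1 : C)) ∧
    (∀ x : Fin d → C, (∀ i, η (x i) = ∑ j, x j ⊗ₜ[ℂ] u j i) →
      x ∈ Submodule.span ℂ (Set.range (fun k => (fun i => c k i : Fin d → C)))) ∧
    Module.finrank ℂ (multipletSubmodule η u) = p := by
  have hli := linearIndependent_rows_of_mul_conjTranspose_eq_one hcc
  have hspan : ∀ x : Fin d → C, (∀ i, η (x i) = ∑ j, x j ⊗ₜ[ℂ] u j i) →
      x ∈ Submodule.span ℂ (Set.range (fun k => (fun i => c k i : Fin d → C))) := by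
    intro x hx
    choose z hz using fun k => herg _
      (coaction_sum_mul_eq_tmul_one η hu hx (hstar d u hu hu' (c k) (hrows k)))
    rw [Submodule.mem_span_range_iff_exists_fun]
    refine ⟨z, funext fun i => ?_⟩
    rw [← habs x hx i]
    calc (∑ k, z k • fun i => c k i) i = ∑ k, (∑ j, x j * star (c k j)) * c k i := by
          simp [Finset.sum_apply, hz]
      _ = ∑ j, x j * (cᴴ * c) j i := by
          simp only [Matrix.mul_apply, Matrix.conjTranspose_apply, Finset.sum_mul,
            Finset.mul_sum, mul_assoc]
          exact Finset.sum_comm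
  refine ⟨hli, fun k l => ?_, hspan, ?_⟩
  · simpa [Matrix.mul_apply, Matrix.one_apply] using congrFun (congrFun hcc k) l
  · have hL : multipletSubmodule η u =
        Submodule.span ℂ (Set.range (fun k => (fun i => c k i : Fin d → C))) := by
      refine le_antisymm (fun x hx => hspan x (mem_multipletSubmodule_iff.mp hx)) ?_
      rw [Submodule.span_le]
      rintro _ ⟨k, rfl⟩
      exact mem_multipletSubmodule_iff.mpr (hrows k)
    rw [hL, finrank_span_eq_card hli, Fintype.card_fin]
end
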